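/- arXiv:2204.10528 — 4 statements merged into one kernel-verified Lean document; each statement's English description precedes it below -/
import Mathlib

section
/- Let a ∈ ℂ with Im a > −1 and let g : ℝ → ℂ be a Schwartz function. Define G : ℝ∖{0} → ℂ by G(s) = (i/2) s^{(ia−1)/2} ∫_s^∞ w^{(−ia−1)/2} g(w) dw for s > 0, and G(s) = (i/2) (−s)^{(ia−1)/2} ∫_{−∞}^s (−w)^{(−ia−1)/2} g(w) dw for s < 0 (complex powers of positive reals). Then the integrals converge absolutely, G is differentiable on ℝ∖{0}, and for every s ≠ 0 one has 2 i s G′(s) + (a + i) G(s) = g(s); equivalently, a G(s) − (T G)(s) = g(s) where (TG)(s) = −i G(s) − 2 i s G′(s), so G is the resolvent R(a; XP+PX)g of the anti-commutator operator away from 0. -/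
open MeasureTheory Set

/-- The resolvent kernel of the anti-commutator operator `XP + PX` at `a`, applied to `g`:
for `s > 0`, `G(s) = (i/2) s^((ia−1)/2) ∫_s^∞ w^((−ia−1)/2) g(w) dw`, and for `s < 0`,
`G(s) = (i/2) (−s)^((ia−1)/2) ∫_{−∞}^s (−w)^((−ia−1)/2) g(w) dw`. -/
noncomputable def antiCommResolvent (a : ℂ) (g : ℝ → ℂ) (s : ℝ) : ℂ :=
  if 0 < s then
    (Complex.I / 2) * (s : ℂ) ^ ((Complex.I * a - 1) / 2) *
      ∫ w in Ioi s, (w : ℂ) ^ ((-(Complex.I * a) - 1) / 2) * g w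
  else
    (Complex.I / 2) * ((-s : ℝ) : ℂ) ^ ((Complex.I * a - 1) / 2) *
      ∫ w in Iic s, (((-w : ℝ)) : ℂ) ^ ((-(Complex.I * a) - 1) / 2) * g w

lemma integrableOn_Ioi_cpow_mul {g : ℝ → ℂ} (hg : Continuous g)
    (hg_int : ∀ k : ℕ, Integrable fun x : ℝ => ‖x‖ ^ k * ‖g x‖) (β : ℂ) {s : ℝ} (hs : 0 < s) :
    IntegrableOn (fun w : ℝ => (w : ℂ) ^ β * g w) (Ioi s) := by
  obtain ⟨k, hk⟩ := exists_nat_ge β.re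
  refine ((hg_int k).integrableOn.const_mul (s ^ (β.re - k))).mono' ?_ ?_
  · refine ContinuousOn.aestronglyMeasurable (fun w hw => ?_) measurableSet_Ioi
    have hw0 : w ≠ 0 := (hs.trans hw).ne'
    exact ((Complex.continuousAt_ofReal_cpow_const w β (.inr hw0)).mul
      hg.continuousAt).continuousWithinAt
  · refine (ae_restrict_iff' measurableSet_Ioi).2 (.of_forall fun w hw => ?_)
    have hw0 : 0 < w := hs.trans hw
    rw [norm_mul, Complex.norm_cpow_eq_rpow_re_of_pos hw0, ← mul_assoc, Real.norm_of_nonneg hw0.le]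
    gcongr
    calc w ^ β.re = w ^ (β.re - k) * w ^ k := by
          rw [← Real.rpow_natCast, ← Real.rpow_add hw0, sub_add_cancel]
      _ ≤ s ^ (β.re - k) * w ^ k := by
          gcongr ?_ * _
          exact Real.rpow_le_rpow_of_nonpos hs (le_of_lt hw) (sub_nonpos.2 hk)

lemma hasDerivAt_integral_Ioi {E : Type*} [NormedAddCommGroup E] [NormedSpace ℝ E]
    [CompleteSpace E] {f : ℝ → E} {c s : ℝ} (hcs : c < s) (hf : IntegrableOn f (Ioi c))
    (hc : ContinuousOn f (Ioi c)) :
    HasDerivAt (fun x => ∫ w in Ioi x, f w) (-f s) s := by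
  have hmono : ∀ x, c < x → IntegrableOn f (Ioi x) := fun x hx =>
    hf.mono_set (Ioi_subset_Ioi hx.le)
  have hI : IntervalIntegrable f volume s (s + 1) :=
    (intervalIntegrable_iff_integrableOn_Ioc_of_le (by linarith)).2
      ((hmono s hcs).mono_set Ioc_subset_Ioi_self)
  have hd : HasDerivAt (fun x => ∫ w in x..s + 1, f w) (-f s) s :=
    intervalIntegral.integral_hasDerivAt_left hI
      (hc.stronglyMeasurableAtFilter isOpen_Ioi s hcs) (hc.continuousAt (Ioi_mem_nhds hcs))
  refine (hd.add_const (∫ w in Ioi (s + 1), f w)).congr_of_eventuallyEq ?_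
  filter_upwards [Ioi_mem_nhds hcs] with x hx
  exact (intervalIntegral.integral_interval_add_Ioi (hmono x hx) (hmono _ (by linarith))).symm

lemma hasDerivAt_antiCommResolvent_of_pos (a : ℂ) {g : ℝ → ℂ} (hg : Continuous g)
    (hg_int : ∀ k : ℕ, Integrable fun x : ℝ => ‖x‖ ^ k * ‖g x‖) {s : ℝ} (hs : 0 < s) :
    HasDerivAt (antiCommResolvent a g)
      ((g s - (a + Complex.I) * antiCommResolvent a g s) / (2 * Complex.I * s)) s := by
  have hs0 : (s : ℂ) ≠ 0 := by exact_mod_cast hs.ne'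
  have hpow : HasDerivAt (fun y : ℝ => (y : ℂ) ^ ((Complex.I * a - 1) / 2))
      ((Complex.I * a - 1) / 2 * (s : ℂ) ^ ((Complex.I * a - 1) / 2 - 1)) s := by
    simpa using ((hasDerivAt_id (s : ℂ)).cpow_const
      (c := (Complex.I * a - 1) / 2) (Complex.ofReal_mem_slitPlane.2 hs)).comp_ofReal
  have hI := hasDerivAt_integral_Ioi (half_lt_self hs)
    (integrableOn_Ioi_cpow_mul hg hg_int ((-(Complex.I * a) - 1) / 2) (half_pos hs))
    (fun w hw => ((Complex.continuousAt_ofReal_cpow_const w _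
      (.inr ((half_pos hs).trans hw).ne')).mul hg.continuousAt).continuousWithinAt)
  have hinv : (s : ℂ) ^ ((Complex.I * a - 1) / 2) * (s : ℂ) ^ ((-(Complex.I * a) - 1) / 2)
      = (s : ℂ)⁻¹ := by
    rw [← Complex.cpow_add _ _ hs0, ← Complex.cpow_neg_one]
    congr 1
    ring
  have hG := (hpow.const_mul (Complex.I / 2)).mul hI
  refine (hG.congr_of_eventuallyEq ?_).congr_deriv ?_
  · filter_upwards [Ioi_mem_nhds hs] with x hx
    exact if_pos hx
  · rw [antiCommResolvent, if_pos hs, Complex.cpow_sub _ _ hs0, Complex.cpow_one]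
    have h2 : (2 * Complex.I * s) ≠ 0 := by simp [hs0]
    rw [eq_div_iff h2]
    generalize (∫ w in Ioi s, (w : ℂ) ^ ((-(Complex.I * a) - 1) / 2) * g w) = J at *
    generalize (s : ℂ) ^ ((Complex.I * a - 1) / 2) = p at *
    generalize (s : ℂ) ^ ((-(Complex.I * a) - 1) / 2) = q at *
    have hpq : p * q * s = 1 := by rw [hinv, inv_mul_cancel₀ hs0]
    have hps : p / s * s = p := div_mul_cancel₀ p hs0
    linear_combination (Complex.I ^ 2 * (Complex.I * a - 1) / 2 * J) * hps
      - Complex.I ^ 2 * g s * hpq + (J * p * (Complex.I * a) / 2 - g s) * Complex.I_sq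

lemma antiCommResolvent_of_neg (a : ℂ) (g : ℝ → ℂ) {s : ℝ} (hs : s < 0) :
    antiCommResolvent a g s = antiCommResolvent a (fun x => g (-x)) (-s) := by
  rw [antiCommResolvent, antiCommResolvent, if_neg hs.not_gt, if_pos (neg_pos.2 hs),
    ← integral_comp_neg_Iic]
  simp only [neg_neg]

lemma hasDerivAt_antiCommResolvent (a : ℂ) {g : ℝ → ℂ} (hg : Continuous g)
    (hg_int : ∀ k : ℕ, Integrable fun x : ℝ => ‖x‖ ^ k * ‖g x‖) {s : ℝ} (hs : s ≠ 0) :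
    HasDerivAt (antiCommResolvent a g)
      ((g s - (a + Complex.I) * antiCommResolvent a g s) / (2 * Complex.I * s)) s := by
  rcases hs.lt_or_gt with hs | hs
  · have hd := (hasDerivAt_antiCommResolvent_of_pos a (g := fun x => g (-x))
      (hg.comp continuous_neg) (fun k => by simpa using (hg_int k).comp_neg)
      (neg_pos.2 hs)).scomp s (hasDerivAt_neg s)
    refine (hd.congr_of_eventuallyEq ?_).congr_deriv ?_
    · filter_upwards [Iio_mem_nhds hs] with x hx
      exact antiCommResolvent_of_neg a g hx
    · rw [← antiCommResolvent_of_neg a g hs, neg_neg, neg_one_smul, Complex.ofReal_neg, mul_neg,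
        div_neg, neg_neg]
  · exact hasDerivAt_antiCommResolvent_of_pos a hg hg_int hs

/-- For `Im a > −1` and Schwartz `g`, the integrals defining the resolvent
converge absolutely, the resolvent `G` is differentiable away from `0`, and satisfies
`2isG′(s) + (a+i)G(s) = g(s)`, i.e. `aG(s) − (TG)(s) = g(s)` with
`(TG)(s) = −iG(s) − 2isG′(s)`; so `G = R(a; XP+PX)g` away from `0`. -/
theorem antiCommResolvent_spec (a : ℂ) (ha : -1 < a.im) (g : SchwartzMap ℝ ℂ) :
    (∀ s : ℝ, 0 < s →
      IntegrableOn (fun w : ℝ => (w : ℂ) ^ ((-(Complex.I * a) - 1) / 2) * g w) (Ioi s)) ∧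
    (∀ s : ℝ, s < 0 →
      IntegrableOn (fun w : ℝ => (((-w : ℝ)) : ℂ) ^ ((-(Complex.I * a) - 1) / 2) * g w) (Iic s)) ∧
    (∀ s : ℝ, s ≠ 0 → DifferentiableAt ℝ (antiCommResolvent a g) s) ∧
    (∀ s : ℝ, s ≠ 0 →
      2 * Complex.I * s * deriv (antiCommResolvent a g) s
        + (a + Complex.I) * antiCommResolvent a g s = g s) ∧
    (∀ s : ℝ, s ≠ 0 →
      a * antiCommResolvent a g s
        - (-Complex.I * antiCommResolvent a g s
            - 2 * Complex.I * s * deriv (antiCommResolvent a g) s) = g s) := by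
  have hg_int := g.integrable_pow_mul volume
  have hd := fun s (hs : s ≠ 0) => hasDerivAt_antiCommResolvent a g.continuous hg_int hs
  have hode : ∀ s : ℝ, s ≠ 0 →
      2 * Complex.I * s * deriv (antiCommResolvent a g) s
        + (a + Complex.I) * antiCommResolvent a g s = g s := fun s hs => by
    have h2 : 2 * Complex.I * s ≠ 0 := by simp [hs]
    rw [(hd s hs).deriv, mul_div_cancel₀ _ h2, sub_add_cancel]
  refine ⟨fun s hs => integrableOn_Ioi_cpow_mul g.continuous hg_int _ hs, fun s hs => ?_,
    fun s hs => (hd s hs).differentiableAt, hode, fun s hs => ?_⟩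
  · have h := integrableOn_Ioi_cpow_mul (g := fun x => g (-x)) (g.continuous.comp continuous_neg)
      (fun k => by simpa using (hg_int k).comp_neg) ((-(Complex.I * a) - 1) / 2) (neg_pos.2 hs)
    rw [integrableOn_Iic_iff_integrableOn_Iio]
    simpa using h.comp_neg
  · linear_combination hode s hs
end

section
/- Let Φ(x) = π^{−1/4} e^{−x²/2} and let T = XP + PX act on Schwartz functions by (Tf)(x) = −i f(x) − 2i x f′(x). Then for every real t with |t| < π/4, the series ∑_{n=0}^∞ ((it)^n / n!) · ∫_ℝ conj(Φ(x)) (TⁿΦ)(x) dx converges and equals √(sech 2t) = √(2/(e^{2t}+e^{−2t})); i.e., the vacuum characteristic function of the anti-commutator operator XP+PX is ⟨Φ, e^{it(XP+PX)}Φ⟩ = (sech 2t)^{1/2}. -/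
open MeasureTheory

/-- The anti-commutator operator `T = XP + PX` acting on functions (with `ħ = 1`):
`(Tf)(x) = −i f(x) − 2i x f′(x)`. -/
noncomputable def antiCommutatorOp (f : ℝ → ℂ) : ℝ → ℂ :=
  fun x => -Complex.I * f x - 2 * Complex.I * x * deriv f x

/-- The vacuum vector `Φ(x) = π^{−1/4} e^{−x²/2}`. -/
noncomputable def vacuum (x : ℝ) : ℂ :=
  ((Real.pi ^ (-(1 / 4 : ℝ)) * Real.exp (-x ^ 2 / 2) : ℝ) : ℂ)

open Polynomial in
/-- The operator on polynomials `p` such that `iT` maps `p(x²)Φ(x)` to `(Lp)(x²)Φ(x)`. -/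
noncomputable def dilationGenerator (p : ℂ[X]) : ℂ[X] :=
  p + 4 * X * derivative p - 2 * X * p

/-- The even moments `∫ x^(2k) Φ(x)² dx` of the vacuum distribution. -/
noncomputable def vacuumMoment (k : ℕ) : ℝ := Real.Gamma (k + 1 / 2) / Real.sqrt Real.pi

open Polynomial in
/-- The linear map on polynomials sending `X^k` to `vacuumMoment k • X^k`. -/
noncomputable def momentTransform : ℂ[X] →ₗ[ℂ] ℂ[X] :=
  Polynomial.lsum fun k => (vacuumMoment k : ℂ) • Polynomial.monomial k

lemma vacuumMoment_zero : vacuumMoment 0 = 1 := by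
  have : Real.sqrt Real.pi ≠ 0 := by positivity
  simp only [vacuumMoment, Nat.cast_zero, zero_add, Real.Gamma_one_half_eq]
  exact div_self this

lemma vacuumMoment_succ (k : ℕ) :
    vacuumMoment (k + 1) = (2 * k + 1) / 2 * vacuumMoment k := by
  have h : ((k + 1 : ℕ) : ℝ) + 1 / 2 = (k + 1 / 2 : ℝ) + 1 := by push_cast; ring
  rw [vacuumMoment, h, Real.Gamma_add_one (by positivity), vacuumMoment]
  ring

lemma momentTransform_monomial (k : ℕ) (a : ℂ) :
    momentTransform (Polynomial.monomial k a) =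
      Polynomial.C (vacuumMoment k : ℂ) * Polynomial.monomial k a := by
  simp [momentTransform, Polynomial.lsum_apply, Polynomial.sum_monomial_index,
    Polynomial.smul_monomial, Polynomial.C_mul_monomial]

lemma dilationGenerator_add (p q : Polynomial ℂ) :
    dilationGenerator (p + q) = dilationGenerator p + dilationGenerator q := by
  simp only [dilationGenerator, Polynomial.derivative_add]
  ring

open Polynomial in
lemma dilationGenerator_monomial (k : ℕ) (a : ℂ) :
    dilationGenerator (monomial k a) =
      monomial k ((4 * k + 1) * a) + monomial (k + 1) (-2 * a) := by
  have h2 : C (2 : ℂ) = 2 := map_ofNat C 2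
  have h4 : C (4 : ℂ) = 4 := map_ofNat C 4
  rw [dilationGenerator]
  simp only [← C_mul_X_pow_eq_monomial, derivative_C_mul, derivative_X_pow]
  rcases k with _ | k
  · simp [h2]; ring
  · simp [h2, h4]; ring

open Polynomial in
lemma momentTransform_dilationGenerator (p : ℂ[X]) :
    momentTransform (dilationGenerator p) =
      (1 - X) * momentTransform p
        + 2 * (2 * X - X ^ 2) * derivative (momentTransform p) := by
  induction p using Polynomial.induction_on' with
  | add p q hp hq =>
    simp only [dilationGenerator_add, map_add, hp, hq]
    ring
  | monomial k a =>
    rw [dilationGenerator_monomial, map_add]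
    simp only [momentTransform_monomial, vacuumMoment_succ, derivative_C_mul]
    simp only [← C_mul_X_pow_eq_monomial, derivative_C_mul, derivative_X_pow]
    have h2 : (C (((2 * k + 1) / 2 * vacuumMoment k : ℝ) : ℂ)) * C (-2 * a)
        = -(2 * (k : ℂ[X]) + 1) * C (vacuumMoment k : ℂ) * C a := by
      have h3 : -(2 * (k : ℂ[X]) + 1) = C (-(2 * k + 1) : ℂ) := by
        simp [map_ofNat C 2]
      rw [h3, ← C_mul, ← C_mul, ← C_mul]
      congr 1
      push_cast
      ring
    rw [← mul_assoc (C (((2 * k + 1) / 2 * vacuumMoment k : ℝ) : ℂ)), h2]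
    rcases k with _ | k
    · simp; ring
    · simp [map_ofNat C 4]; ring

lemma hasDerivAt_vacuum (x : ℝ) : HasDerivAt vacuum (-x * vacuum x) x := by
  have h : HasDerivAt (fun x : ℝ => Real.pi ^ (-(1 / 4 : ℝ)) * Real.exp (-x ^ 2 / 2))
      (Real.pi ^ (-(1 / 4 : ℝ)) * (Real.exp (-x ^ 2 / 2) * (-(2 * x) / 2))) x := by
    have := (((hasDerivAt_pow 2 x).neg.div_const 2).exp).const_mul (Real.pi ^ (-(1 / 4 : ℝ)))
    simpa using this
  refine h.ofReal_comp.congr_deriv ?_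
  simp only [vacuum]
  push_cast
  ring

lemma antiCommutatorOp_polynomial_mul_vacuum (a : ℂ) (p : Polynomial ℂ) :
    antiCommutatorOp (fun x : ℝ => a * (p.eval ((x : ℂ) ^ 2) * vacuum x)) =
      fun x : ℝ => (-Complex.I * a) *
        ((dilationGenerator p).eval ((x : ℂ) ^ 2) * vacuum x) := by
  funext x
  have h1 : HasDerivAt (fun x : ℝ => p.eval ((x : ℂ) ^ 2))
      (p.derivative.eval ((x : ℂ) ^ 2) * (2 * x)) x := by
    have h := (p.hasDerivAt ((x : ℂ) ^ 2)).comp (x : ℂ) (hasDerivAt_pow 2 (x : ℂ))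
    simpa using h.comp_ofReal
  have h2 := ((h1.mul (hasDerivAt_vacuum x)).const_mul a).deriv
  rw [antiCommutatorOp]
  simp only [Pi.mul_apply] at h2
  erw [h2]
  simp [dilationGenerator]
  ring

lemma antiCommutatorOp_iterate_vacuum (n : ℕ) :
    antiCommutatorOp^[n] vacuum = fun x : ℝ =>
      (-Complex.I) ^ n * ((dilationGenerator^[n] 1).eval ((x : ℂ) ^ 2) * vacuum x) := by
  induction n with
  | zero => simp
  | succ n ih =>
    rw [Function.iterate_succ_apply', ih, antiCommutatorOp_polynomial_mul_vacuum,
      Function.iterate_succ_apply', pow_succ']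

lemma conj_vacuum_mul_vacuum (x : ℝ) :
    (starRingEnd ℂ) (vacuum x) * vacuum x =
      ((1 / Real.sqrt Real.pi * Real.exp (-1 * x ^ 2) : ℝ) : ℂ) := by
  rw [vacuum, Complex.conj_ofReal, ← Complex.ofReal_mul]
  congr 1
  have h1 : Real.pi ^ (-(1 / 4 : ℝ)) * Real.pi ^ (-(1 / 4 : ℝ)) = 1 / Real.sqrt Real.pi := by
    rw [← Real.rpow_add Real.pi_pos, Real.sqrt_eq_rpow, one_div (Real.pi ^ (1 / 2 : ℝ)),
      ← Real.rpow_neg Real.pi_pos.le]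
    norm_num
  have h2 : Real.exp (-x ^ 2 / 2) * Real.exp (-x ^ 2 / 2) = Real.exp (-1 * x ^ 2) := by
    rw [← Real.exp_add]
    ring_nf
  rw [mul_mul_mul_comm, h1, h2]

lemma integral_pow_mul_exp_neg_sq (k : ℕ) :
    ∫ x : ℝ, x ^ (2 * k) * Real.exp (-1 * x ^ 2) = Real.Gamma (k + 1 / 2) := by
  have h := integral_comp_abs (f := fun x : ℝ => x ^ (2 * k) * Real.exp (-1 * x ^ 2))
  simp only [sq_abs, pow_mul] at h
  simp only [pow_mul]
  rw [h]
  have h2 := integral_rpow_mul_exp_neg_mul_rpow (p := 2) (q := (2 * k : ℕ)) (b := 1)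
    (by norm_num) (by have : (0 : ℝ) ≤ (2 * k : ℕ) := by positivity
                      linarith) one_pos
  simp only [Real.rpow_natCast, Real.rpow_two, Real.one_rpow, pow_mul] at h2
  rw [h2]
  have h3 : (((2 * k : ℕ) : ℝ) + 1) / 2 = k + 1 / 2 := by push_cast; ring
  rw [h3]
  ring

lemma integrable_pow_mul_exp_neg_sq (k : ℕ) :
    Integrable fun x : ℝ => x ^ (2 * k) * Real.exp (-1 * x ^ 2) := by
  have h := integrable_rpow_mul_exp_neg_mul_sq (b := 1) one_pos (s := (2 * k : ℕ))
    (by have : (0 : ℝ) ≤ (2 * k : ℕ) := by positivity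
        linarith)
  simpa only [Real.rpow_natCast] using h

lemma integral_polynomial_mul_vacuum (p : Polynomial ℂ) :
    Integrable (fun x : ℝ =>
        (starRingEnd ℂ) (vacuum x) * (p.eval ((x : ℂ) ^ 2) * vacuum x)) ∧
      ∫ x : ℝ, (starRingEnd ℂ) (vacuum x) * (p.eval ((x : ℂ) ^ 2) * vacuum x) =
        (momentTransform p).eval 1 := by
  induction p using Polynomial.induction_on' with
  | add p q hp hq =>
    simp only [Polynomial.eval_add, add_mul, mul_add, map_add]
    exact ⟨hp.1.add hq.1, by rw [integral_add hp.1 hq.1, hp.2, hq.2]⟩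
  | monomial k a =>
    have h : (fun x : ℝ => (starRingEnd ℂ) (vacuum x) *
        ((Polynomial.monomial k a).eval ((x : ℂ) ^ 2) * vacuum x)) = fun x : ℝ =>
        (a * ((1 / Real.sqrt Real.pi : ℝ) : ℂ)) *
          ((x ^ (2 * k) * Real.exp (-1 * x ^ 2) : ℝ) : ℂ) := by
      funext x
      rw [mul_left_comm, conj_vacuum_mul_vacuum, Polynomial.eval_monomial]
      push_cast
      ring
    rw [h]
    refine ⟨(integrable_pow_mul_exp_neg_sq k).ofReal.const_mul _, ?_⟩
    rw [integral_const_mul, integral_complex_ofReal, integral_pow_mul_exp_neg_sq,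
      momentTransform_monomial, vacuumMoment]
    simp only [Polynomial.eval_mul, Polynomial.eval_C, Polynomial.eval_monomial, one_pow]
    push_cast
    ring

lemma re_cosh_two_mul_pos {z : ℂ} (hz : z ∈ Metric.ball (0 : ℂ) (Real.pi / 4)) :
    0 < (Complex.cosh (2 * z)).re := by
  have h1 : |z.im| < Real.pi / 4 :=
    (Complex.abs_im_le_norm z).trans_lt (by simpa using hz)
  rw [abs_lt] at h1
  have h2 : (Complex.cosh (2 * z)).re = Real.cosh (2 * z.re) * Real.cos (2 * z.im) := by
    have h3 : 2 * z = ((2 * z.re : ℝ) : ℂ) + ((2 * z.im : ℝ) : ℂ) * Complex.I := by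
      apply Complex.ext <;> simp
    rw [h3, Complex.cosh_add, Complex.cosh_mul_I, Complex.sinh_mul_I,
      ← Complex.ofReal_cosh, ← Complex.ofReal_cos, ← Complex.ofReal_sinh, ← Complex.ofReal_sin]
    simp only [Complex.add_re, Complex.mul_re, Complex.mul_im, Complex.ofReal_re,
      Complex.ofReal_im, Complex.I_re, Complex.I_im]
    ring
  rw [h2]
  exact mul_pos (Real.cosh_pos _) (Real.cos_pos_of_mem_Ioo ⟨by linarith, by linarith⟩)

lemma hasDerivAt_cosh_cpow_mul_eval (p : Polynomial ℂ) {z : ℂ}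
    (hz : z ∈ Metric.ball (0 : ℂ) (Real.pi / 4)) :
    HasDerivAt (fun z : ℂ => Complex.cosh (2 * z) ^ (-(1 / 2) : ℂ) *
        (momentTransform p).eval (1 + Complex.sinh (2 * z) / Complex.cosh (2 * z)))
      (Complex.cosh (2 * z) ^ (-(1 / 2) : ℂ) * (momentTransform (dilationGenerator p)).eval
        (1 + Complex.sinh (2 * z) / Complex.cosh (2 * z))) z := by
  have hre := re_cosh_two_mul_pos hz
  have hne : Complex.cosh (2 * z) ≠ 0 := fun h => by simp [h] at hre
  have hm : HasDerivAt (fun z : ℂ => 2 * z) 2 z := by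
    simpa using (hasDerivAt_id z).const_mul 2
  have hc := hm.ccosh
  have hs := hm.csinh
  have hF := hc.cpow_const (c := (-(1 / 2) : ℂ)) (Or.inl hre)
  have hu := (hs.div hc hne).const_add 1
  have hp := ((momentTransform p).hasDerivAt
    (1 + Complex.sinh (2 * z) / Complex.cosh (2 * z))).comp z hu
  refine (hF.mul hp).congr_deriv ?_
  rw [momentTransform_dilationGenerator, Complex.cpow_sub _ _ hne, Complex.cpow_one]
  simp only [Function.comp_apply, Pi.div_apply, Polynomial.eval_add, Polynomial.eval_mul,
    Polynomial.eval_sub,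
    Polynomial.eval_one, Polynomial.eval_X, Polynomial.eval_pow, Polynomial.eval_ofNat]
  field_simp
  ring

lemma iteratedDeriv_cosh_cpow (n : ℕ) {z : ℂ}
    (hz : z ∈ Metric.ball (0 : ℂ) (Real.pi / 4)) :
    iteratedDeriv n (fun z : ℂ => Complex.cosh (2 * z) ^ (-(1 / 2) : ℂ)) z =
      Complex.cosh (2 * z) ^ (-(1 / 2) : ℂ) * (momentTransform (dilationGenerator^[n] 1)).eval
        (1 + Complex.sinh (2 * z) / Complex.cosh (2 * z)) := by
  induction n generalizing z with
  | zero =>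
    have h : momentTransform 1 = 1 := by
      have := momentTransform_monomial 0 1
      simpa [vacuumMoment_zero] using this
    simp [h]
  | succ n ih =>
    rw [iteratedDeriv_succ, Function.iterate_succ_apply',
      ← (hasDerivAt_cosh_cpow_mul_eval _ hz).deriv]
    apply Filter.EventuallyEq.deriv_eq
    filter_upwards [Metric.isOpen_ball.mem_nhds hz] with w hw using ih hw

lemma cosh_cpow_ofReal (t : ℝ) :
    Complex.cosh (2 * (t : ℂ)) ^ (-(1 / 2) : ℂ) =
      ((Real.sqrt (2 / (Real.exp (2 * t) + Real.exp (-(2 * t)))) : ℝ) : ℂ) := by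
  have h1 : 2 / (Real.exp (2 * t) + Real.exp (-(2 * t))) = (Real.cosh (2 * t))⁻¹ := by
    rw [Real.cosh_eq, inv_div]
  rw [h1, Real.sqrt_inv, Real.sqrt_eq_rpow, ← Real.rpow_neg (Real.cosh_pos _).le,
    Complex.ofReal_cpow (Real.cosh_pos _).le]
  push_cast
  rfl

/-- For `|t| < π/4`, the exponential moment series
`∑_{n=0}^∞ ((it)^n/n!) ⟨Φ, TⁿΦ⟩` of the anti-commutator operator `T = XP + PX` converges and
sums to `√(sech 2t) = √(2/(e^{2t}+e^{−2t}))`: the vacuum characteristic function of `XP+PX`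
is `⟨Φ, e^{it(XP+PX)}Φ⟩ = (sech 2t)^{1/2}`. -/
theorem anticommutator_vacuum_characteristic_function (t : ℝ) (ht : |t| < Real.pi / 4) :
    HasSum
      (fun n : ℕ => (Complex.I * t) ^ n / (Nat.factorial n : ℂ) *
        ∫ x : ℝ, (starRingEnd ℂ) (vacuum x) * (antiCommutatorOp^[n] vacuum) x)
      ((Real.sqrt (2 / (Real.exp (2 * t) + Real.exp (-(2 * t)))) : ℝ) : ℂ) := by
  have hball : (t : ℂ) ∈ Metric.ball (0 : ℂ) (Real.pi / 4) := by simpa using ht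
  have hdiff : DifferentiableOn ℂ (fun z : ℂ => Complex.cosh (2 * z) ^ (-(1 / 2) : ℂ))
      (Metric.ball (0 : ℂ) (Real.pi / 4)) := fun z hz =>
    ((by fun_prop : DifferentiableAt ℂ (fun z : ℂ => Complex.cosh (2 * z)) z).cpow_const
      (Or.inl (re_cosh_two_mul_pos hz))).differentiableWithinAt
  have hsum := Complex.hasSum_taylorSeries_on_ball hdiff hball
  simp only [cosh_cpow_ofReal] at hsum
  refine hsum.congr_fun fun n => ?_
  rw [iteratedDeriv_cosh_cpow n (Metric.mem_ball_self (by positivity)),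
    antiCommutatorOp_iterate_vacuum]
  simp only [mul_left_comm _ ((-Complex.I) ^ n)]
  rw [integral_const_mul, (integral_polynomial_mul_vacuum _).2]
  have hI : Complex.I ^ n * (-Complex.I) ^ n = 1 := by
    rw [← mul_pow]
    simp
  simp only [mul_zero, Complex.cosh_zero, Complex.sinh_zero, zero_div, add_zero,
    Complex.one_cpow, one_mul, sub_zero, smul_eq_mul, mul_pow]
  linear_combination ((t : ℂ) ^ n / (n.factorial : ℂ) *
    (momentTransform (dilationGenerator^[n] 1)).eval 1) * hI
end

section
/- For every a ∈ ℂ, the function M₁(z; a) = e^{−z²/4} · ∑_{n=0}^∞ ((1/4 − a/2)_n / ((1/2)_n · n!)) · (z²/2)^n (the series converging for all z ∈ ℂ) satisfies the Weber differential equation in canonical form: ∂²M₁/∂z²(z; a) − (z²/4 − a) · M₁(z; a) = 0 for all z. -/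
/-- A power series converging everywhere has an everywhere convergent derived series. -/
lemma summable_derived_of_entire {c : ℕ → ℂ} (h : ∀ z : ℂ, Summable fun n => c n * z ^ n) (z : ℂ) :
    Summable fun n : ℕ => ((n + 1 : ℂ) * c (n + 1)) * z ^ n := by
  have hs := ((summable_nat_add_iff 1).2 (h ((2 * (‖z‖ + 1) : ℝ) : ℂ))).norm
  refine Summable.of_norm_bounded hs fun n => ?_
  have hn : ((n : ℝ) + 1) ≤ 2 ^ (n + 1) := by exact_mod_cast (Nat.lt_two_pow_self (n := n + 1)).le
  have hz : ‖z‖ ^ n ≤ (‖z‖ + 1) ^ (n + 1) :=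
    (pow_le_pow_left₀ (norm_nonneg z) (by linarith) n).trans
      (pow_le_pow_right₀ (by linarith [norm_nonneg z]) n.le_succ)
  have hc : ‖((n : ℂ) + 1)‖ = (n : ℝ) + 1 := by exact_mod_cast Complex.norm_natCast (n + 1)
  rw [norm_mul, norm_mul, norm_mul, norm_pow, norm_pow, hc, Complex.norm_real, Real.norm_of_nonneg
    (by positivity), mul_pow]
  calc ((n : ℝ) + 1) * ‖c (n + 1)‖ * ‖z‖ ^ n
      ≤ 2 ^ (n + 1) * ‖c (n + 1)‖ * (‖z‖ + 1) ^ (n + 1) := by gcongr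
    _ = ‖c (n + 1)‖ * (2 ^ (n + 1) * (‖z‖ + 1) ^ (n + 1)) := by ring

/-- An everywhere convergent power series may be differentiated termwise. -/
lemma hasDerivAt_tsum_of_entire {c : ℕ → ℂ} (h : ∀ z : ℂ, Summable fun n => c n * z ^ n) (z : ℂ) :
    HasDerivAt (fun w => ∑' n, c n * w ^ n)
      (∑' n : ℕ, ((n + 1 : ℂ) * c (n + 1)) * z ^ n) z := by
  have hR : Summable fun n : ℕ => ‖c n * (n * ((‖z‖ + 1 : ℝ) : ℂ) ^ (n - 1))‖ := by
    refine ((summable_nat_add_iff 1).1 ?_)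
    refine (summable_derived_of_entire h ((‖z‖ + 1 : ℝ) : ℂ)).norm.congr fun n => ?_
    push_cast
    congr 1
    ring
  have hb : ∀ n : ℕ, ∀ w ∈ Metric.ball (0 : ℂ) (‖z‖ + 1),
      ‖c n * (n * w ^ (n - 1))‖ ≤ ‖c n * (n * ((‖z‖ + 1 : ℝ) : ℂ) ^ (n - 1))‖ := by
    intro n w hw
    rw [mem_ball_zero_iff] at hw
    rw [norm_mul, norm_mul, norm_mul, norm_mul, norm_pow, norm_pow, Complex.norm_real,
      Real.norm_of_nonneg (by positivity)]
    gcongr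
  have hz : z ∈ Metric.ball (0 : ℂ) (‖z‖ + 1) := by simp
  have hd := hasDerivAt_tsum_of_isPreconnected hR Metric.isOpen_ball
    (convex_ball (0 : ℂ) (‖z‖ + 1)).isPreconnected
    (fun n w _ => (hasDerivAt_pow n w).const_mul (c n)) hb hz (h z) hz
  refine hd.congr_deriv ?_
  rw [(Summable.of_norm_bounded hR fun n => hb n z hz).tsum_eq_zero_add]
  simp only [Nat.cast_zero, zero_mul, mul_zero, zero_add, Nat.add_sub_cancel]
  refine tsum_congr fun n => ?_
  push_cast
  ring

/-- Multiplying the derived series by the variable gives the Euler operator on coefficients. -/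
lemma hasSum_euler_of_entire {c : ℕ → ℂ} (h : ∀ z : ℂ, Summable fun n => c n * z ^ n) (z : ℂ) :
    HasSum (fun n : ℕ => (n * c n) * z ^ n)
      (z * ∑' n : ℕ, ((n + 1 : ℂ) * c (n + 1)) * z ^ n) := by
  rw [← hasSum_nat_add_iff' 1]
  simp only [Finset.sum_range_one, Nat.cast_zero, zero_mul, sub_zero]
  refine ((summable_derived_of_entire h z).hasSum.mul_left z).congr_fun ?_
  intro n
  push_cast
  ring

/-- The recurrence for the coefficients of Kummer's function implies Kummer's equation. -/
lemma kummer_equation_of_recurrence {c : ℕ → ℂ} {α γ : ℂ}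
    (h : ∀ z : ℂ, Summable fun n => c n * z ^ n)
    (hc : ∀ n : ℕ, (n + 1) * (γ + n) * c (n + 1) = (α + n) * c n) (z : ℂ) :
    z * (∑' n : ℕ, ((n + 1 : ℂ) * (((n + 1 : ℕ) + 1 : ℂ) * c (n + 1 + 1))) * z ^ n) +
      (γ - z) * (∑' n : ℕ, ((n + 1 : ℂ) * c (n + 1)) * z ^ n) -
        α * ∑' n, c n * z ^ n = 0 := by
  have h' := summable_derived_of_entire h
  have hsum := (((hasSum_euler_of_entire h' z).add ((h' z).hasSum.mul_left γ)).sub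
    (hasSum_euler_of_entire h z)).sub ((h z).hasSum.mul_left α)
  have hzero : (fun n : ℕ => n * ((n + 1 : ℂ) * c (n + 1)) * z ^ n +
      γ * (((n + 1 : ℂ) * c (n + 1)) * z ^ n) - n * c n * z ^ n - α * (c n * z ^ n)) =
      fun _ => 0 := by
    funext n
    linear_combination z ^ n * hc n
  rw [hzero] at hsum
  rw [← hsum.unique hasSum_zero]
  ring

/-- A coefficient sequence satisfying Kummer's recurrence defines an entire power series. -/
lemma summable_of_kummer_recurrence {c : ℕ → ℂ} {α γ : ℂ} (hγ : ∀ n : ℕ, γ + n ≠ 0)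
    (hc : ∀ n : ℕ, (n + 1) * (γ + n) * c (n + 1) = (α + n) * c n) (z : ℂ) :
    Summable fun n => c n * z ^ n := by
  have hstep : ∀ n : ℕ, c (n + 1) * z ^ (n + 1) =
      ((α + n) / (γ + n) * (1 / ((n : ℂ) + 1)) * z) * (c n * z ^ n) := by
    intro n
    have hn : (n : ℂ) + 1 ≠ 0 := Nat.cast_add_one_ne_zero n
    have := hγ n
    field_simp
    linear_combination z ^ (n + 1) * hc n
  have hlim : Filter.Tendsto (fun n : ℕ => ‖(α + n) / (γ + n) * (1 / ((n : ℂ) + 1)) * z‖)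
      Filter.atTop (nhds 0) := by
    have h1 : Filter.Tendsto (fun n : ℕ => (α + n) / (γ + n)) Filter.atTop (nhds (1 : ℂ)) := by
      simpa using tendsto_add_mul_div_add_mul_atTop_nhds α γ (1 : ℂ) (one_ne_zero (α := ℂ))
    have h2 : Filter.Tendsto (fun n : ℕ => 1 / ((n : ℂ) + 1)) Filter.atTop (nhds 0) :=
      tendsto_one_div_add_atTop_nhds_zero_nat
    simpa using ((h1.mul h2).mul_const z).norm
  refine summable_of_ratio_norm_eventually_le (r := 1 / 2) (by norm_num) ?_
  filter_upwards [hlim.eventually_le_const (by norm_num : (0 : ℝ) < 1 / 2)] with n hn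
  rw [hstep, norm_mul]
  gcongr


/-- The ascending factorial (Pochhammer symbol) `(w)_n = w(w+1)⋯(w+n−1)` for complex `w`. -/
noncomputable def cAscFact (w : ℂ) (n : ℕ) : ℂ :=
  ∏ i ∈ Finset.range n, (w + i)

/-- The even Weber solution
`M₁(z; a) = e^{−z²/4} ₁F₁(−a/2 + 1/4; 1/2; z²/2)`, written via its power series. -/
noncomputable def weberM1 (a z : ℂ) : ℂ :=
  Complex.exp (-z ^ 2 / 4) *
    ∑' n : ℕ, cAscFact (1 / 4 - a / 2) n / (cAscFact (1 / 2) n * (Nat.factorial n : ℂ)) *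
      (z ^ 2 / 2) ^ n

/-- For every `a ∈ ℂ`, the series defining `M₁(·; a)` converges for all
`z ∈ ℂ` and `M₁` satisfies the Weber differential equation in canonical form:
`M₁″(z; a) − (z²/4 − a) M₁(z; a) = 0`. -/
theorem weberM1_solves_weber (a : ℂ) :
    (∀ z : ℂ, Summable (fun n : ℕ =>
      cAscFact (1 / 4 - a / 2) n / (cAscFact (1 / 2) n * (Nat.factorial n : ℂ)) *
        (z ^ 2 / 2) ^ n)) ∧
    ∀ z : ℂ, iteratedDeriv 2 (weberM1 a) z - (z ^ 2 / 4 - a) * weberM1 a z = 0 := by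
  set c : ℕ → ℂ := fun n =>
    cAscFact (1 / 4 - a / 2) n / (cAscFact (1 / 2) n * (Nat.factorial n : ℂ)) with hcdef
  have hγ : ∀ n : ℕ, (1 / 2 : ℂ) + n ≠ 0 := fun n h => by
    have := congrArg Complex.re h
    norm_num at this
    linarith [(Nat.cast_nonneg n : (0 : ℝ) ≤ n)]
  have hc : ∀ n : ℕ, (n + 1) * ((1 / 2 : ℂ) + n) * c (n + 1) = ((1 / 4 - a / 2) + n) * c n := by
    intro n
    have h0 : cAscFact (1 / 2) n ≠ 0 := Finset.prod_ne_zero_iff.2 fun i _ => hγ i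
    have h1 : (n.factorial : ℂ) ≠ 0 := Nat.cast_ne_zero.2 n.factorial_ne_zero
    have h2 : (n : ℂ) + 1 ≠ 0 := Nat.cast_add_one_ne_zero n
    have h3 := hγ n
    have hs : ∀ w : ℂ, cAscFact w (n + 1) = cAscFact w n * (w + n) := fun w =>
      Finset.prod_range_succ _ n
    simp only [hcdef, hs, Nat.factorial_succ, Nat.cast_mul, Nat.cast_add, Nat.cast_one]
    generalize (1 / 2 : ℂ) + n = g at *
    field_simp
  have hsum := summable_of_kummer_recurrence hγ hc
  refine ⟨fun z => hsum _, fun z => ?_⟩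
  have hsum' := summable_derived_of_entire hsum
  set F : ℂ → ℂ := fun x => ∑' n, c n * x ^ n with hF
  set G : ℂ → ℂ := fun x => ∑' n : ℕ, ((n + 1 : ℂ) * c (n + 1)) * x ^ n with hG
  set H : ℂ → ℂ := fun x =>
    ∑' n : ℕ, ((n + 1 : ℂ) * (((n + 1 : ℕ) + 1 : ℂ) * c (n + 1 + 1))) * x ^ n with hH
  have hM : weberM1 a = fun w => Complex.exp (-w ^ 2 / 4) * F (w ^ 2 / 2) := rfl
  have hq : ∀ w : ℂ, HasDerivAt (fun w : ℂ => w ^ 2 / 2) w w := fun w =>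
    ((hasDerivAt_pow 2 w).div_const 2).congr_deriv (by norm_num)
  have hE : ∀ w : ℂ, HasDerivAt (fun w : ℂ => Complex.exp (-w ^ 2 / 4))
      (Complex.exp (-w ^ 2 / 4) * (-w / 2)) w := fun w =>
    (((hasDerivAt_pow 2 w).neg.div_const 4).cexp).congr_deriv (by norm_num; ring)
  have hFq : ∀ w : ℂ, HasDerivAt (fun w : ℂ => F (w ^ 2 / 2)) (G (w ^ 2 / 2) * w) w := fun w =>
    HasDerivAt.comp (h₂ := F) w (hasDerivAt_tsum_of_entire hsum (w ^ 2 / 2)) (hq w)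
  have hGq : ∀ w : ℂ, HasDerivAt (fun w : ℂ => G (w ^ 2 / 2)) (H (w ^ 2 / 2) * w) w := fun w =>
    HasDerivAt.comp (h₂ := G) w (hasDerivAt_tsum_of_entire hsum' (w ^ 2 / 2)) (hq w)
  have hM' : deriv (weberM1 a) = fun w => Complex.exp (-w ^ 2 / 4) * (-w / 2) * F (w ^ 2 / 2) +
      Complex.exp (-w ^ 2 / 4) * (G (w ^ 2 / 2) * w) := by
    funext w
    exact ((hE w).mul (hFq w)).deriv
  have hlin : HasDerivAt (fun w : ℂ => -w / 2) (-1 / 2) z := (hasDerivAt_id z).neg.div_const 2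
  have hM'' := ((((hE z).mul hlin).mul (hFq z)).add
    ((hE z).mul ((hGq z).mul (hasDerivAt_id z)))).deriv
  have hode := kummer_equation_of_recurrence hsum hc (z ^ 2 / 2)
  change z ^ 2 / 2 * H (z ^ 2 / 2) + (1 / 2 - z ^ 2 / 2) * G (z ^ 2 / 2) -
    (1 / 4 - a / 2) * F (z ^ 2 / 2) = 0 at hode
  rw [iteratedDeriv_succ, iteratedDeriv_one, hM']
  refine (congrArg (· - _) hM'').trans ?_
  simp only [hM, Pi.mul_apply, id]
  linear_combination 2 * Complex.exp (-z ^ 2 / 4) * hode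
end

section
/- Let a ∈ ℂ and let g : ℝ → ℂ be continuous with w ↦ g(w/√2)·M₁(w; a) and w ↦ g(w/√2)·M₂(w; a) integrable on (−∞, 0]. Then the function M_p(s) = ∫_{−∞}^{s} g(w/√2) · (M₁(w; a) M₂(s; a) − M₁(s; a) M₂(w; a)) dw is twice differentiable on ℝ and satisfies the non-homogeneous Weber equation in canonical form: M_p″(s) − (s²/4 − a) M_p(s) = g(s/√2) for all s ∈ ℝ. -/
open MeasureTheory Set

/-- The odd Weber solution `M₂(z; a) = z e^{−z²/4} ₁F₁(−a/2 + 3/4; 3/2; z²/2)`. -/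
noncomputable def weberM2 (a z : ℂ) : ℂ :=
  z * Complex.exp (-z ^ 2 / 4) *
    ∑' n : ℕ, cAscFact (3 / 4 - a / 2) n / (cAscFact (3 / 2) n * (Nat.factorial n : ℂ)) *
      (z ^ 2 / 2) ^ n

/-- The variation-of-parameters particular solution
`M_p(s) = ∫_{−∞}^s g(w/√2) (M₁(w;a) M₂(s;a) − M₁(s;a) M₂(w;a)) dw`. -/
noncomputable def weberParticular (a : ℂ) (g : ℝ → ℂ) (s : ℝ) : ℂ :=
  ∫ w in Iic s, g (w / Real.sqrt 2) *
    (weberM1 a w * weberM2 a s - weberM1 a s * weberM2 a w)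

/-- The coefficients of `₁F₁(α; c; t)` as a power series in `t`. -/
noncomputable def kummerCoeff (α c : ℂ) (n : ℕ) : ℂ :=
  cAscFact α n / (cAscFact c n * (Nat.factorial n : ℂ))

/-- The coefficients of the formal derivative of `∑ b n t ^ n`. -/
def derivCoeff (b : ℕ → ℂ) (n : ℕ) : ℂ := (n + 1) * b (n + 1)

/-- Coefficient sequences of power series of exponential type. -/
def IsExpType (b : ℕ → ℂ) : Prop :=
  ∃ K C : ℝ, 0 ≤ K ∧ 0 ≤ C ∧ ∀ n, ‖b n‖ ≤ K * (C ^ n / (Nat.factorial n : ℝ))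

theorem IsExpType.derivCoeff {b : ℕ → ℂ} (hb : IsExpType b) : IsExpType (derivCoeff b) := by
  obtain ⟨K, C, hK, hC, h⟩ := hb
  refine ⟨K * C, C, by positivity, hC, fun n => ?_⟩
  have hn : ‖((n : ℂ) + 1)‖ = (n : ℝ) + 1 := by
    exact_mod_cast Complex.norm_natCast (n + 1)
  rw [_root_.derivCoeff, norm_mul, hn]
  refine (mul_le_mul_of_nonneg_left (h (n + 1)) (by positivity)).trans_eq ?_
  have := Nat.factorial_ne_zero n
  rw [Nat.factorial_succ]
  push_cast
  field_simp
  ring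

theorem IsExpType.norm_mul_pow_le {b : ℕ → ℂ} (hb : IsExpType b) (R : ℝ) :
    ∃ u : ℕ → ℝ, Summable u ∧ ∀ n t, ‖t‖ ≤ R → ‖b n * t ^ n‖ ≤ u n := by
  obtain ⟨K, C, hK, hC, h⟩ := hb
  refine ⟨fun n => K * ((C * R) ^ n / (Nat.factorial n : ℝ)),
    (Real.summable_pow_div_factorial (C * R)).mul_left K, fun n t ht => ?_⟩
  rw [norm_mul, norm_pow]
  calc ‖b n‖ * ‖t‖ ^ n ≤ K * (C ^ n / (Nat.factorial n : ℝ)) * R ^ n := by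
        gcongr
        exact h n
    _ = K * ((C * R) ^ n / (Nat.factorial n : ℝ)) := by rw [mul_pow]; ring

theorem IsExpType.summable {b : ℕ → ℂ} (hb : IsExpType b) (t : ℂ) :
    Summable fun n => b n * t ^ n := by
  obtain ⟨u, hu, h⟩ := hb.norm_mul_pow_le ‖t‖
  exact Summable.of_norm_bounded hu fun n => h n t le_rfl

theorem IsExpType.hasDerivAt {b : ℕ → ℂ} (hb : IsExpType b) (t : ℂ) :
    HasDerivAt (fun t => ∑' n, b n * t ^ n) (∑' n, _root_.derivCoeff b n * t ^ n) t := by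
  obtain ⟨u, hu, h⟩ := hb.derivCoeff.norm_mul_pow_le (‖t‖ + 1)
  have key : HasDerivAt (fun t => ∑' n, b (n + 1) * t ^ (n + 1))
      (∑' n, _root_.derivCoeff b n * t ^ n) t := by
    refine hasDerivAt_tsum_of_isPreconnected (t := Metric.ball 0 (‖t‖ + 1)) (y₀ := t) hu
      Metric.isOpen_ball (convex_ball _ _).isPreconnected (fun n y _ => ?_)
      (fun n y hy => h n y (by simpa using (mem_ball_zero_iff.1 hy).le)) (by simp)
      ((summable_nat_add_iff 1).2 (hb.summable t)) (by simp)
    refine ((hasDerivAt_pow (n + 1) y).const_mul (b (n + 1))).congr_deriv ?_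
    simp [_root_.derivCoeff]
    ring
  have heq : (fun t => ∑' n, b n * t ^ n) = fun t => b 0 + ∑' n, b (n + 1) * t ^ (n + 1) := by
    funext t
    rw [(hb.summable t).tsum_eq_zero_add]
    simp
  rw [heq]
  exact key.const_add (b 0)

theorem IsExpType.hasSum_mul_derivCoeff {b : ℕ → ℂ} (hb : IsExpType b) (t : ℂ) :
    HasSum (fun n : ℕ => (n * b n) * t ^ n) (t * ∑' n, _root_.derivCoeff b n * t ^ n) := by
  have h := (hb.derivCoeff.summable t).hasSum.mul_left t
  refine (hasSum_nat_add_iff' 1).1 ?_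
  simp only [Finset.sum_range_one, Nat.cast_zero, zero_mul, sub_zero]
  refine h.congr_fun fun n => ?_
  simp [_root_.derivCoeff]
  ring

theorem cAscFact_succ (w : ℂ) (n : ℕ) : cAscFact w (n + 1) = cAscFact w n * (w + n) :=
  Finset.prod_range_succ _ _

theorem kummerCoeff_succ {c : ℂ} (α : ℂ) (hc : ∀ n : ℕ, c + n ≠ 0) (n : ℕ) :
    (c + n) * ((n + 1) * kummerCoeff α c (n + 1)) = (α + n) * kummerCoeff α c n := by
  have h1 : cAscFact c n ≠ 0 := Finset.prod_ne_zero_iff.2 fun i _ => hc i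
  have h2 := hc n
  have h3 : (n : ℂ) + 1 ≠ 0 := by exact_mod_cast n.succ_ne_zero
  have h4 : (Nat.factorial n : ℂ) ≠ 0 := by exact_mod_cast n.factorial_ne_zero
  rw [kummerCoeff, kummerCoeff, cAscFact_succ, cAscFact_succ, Nat.factorial_succ]
  push_cast
  field_simp

theorem kummerCoeff_isExpType (α : ℂ) {c : ℝ} (hc : 1 / 2 ≤ c) :
    IsExpType (kummerCoeff α c) := by
  refine ⟨1, 2 * (‖α‖ + 1), zero_le_one, by positivity, fun n => ?_⟩
  rw [one_mul]
  induction n with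
  | zero => simp [kummerCoeff, cAscFact]
  | succ n ih =>
    have hne : ∀ n : ℕ, (c : ℂ) + n ≠ 0 := fun n => by
      have : c + (n : ℝ) ≠ 0 := by positivity
      exact_mod_cast this
    have h := congrArg norm (kummerCoeff_succ α hne n)
    have hn : ‖((n : ℂ) + 1)‖ = (n : ℝ) + 1 := by exact_mod_cast Complex.norm_natCast (n + 1)
    have hcn : ‖(c : ℂ) + n‖ = c + n := by
      rw [← Complex.ofReal_natCast, ← Complex.ofReal_add, Complex.norm_real, Real.norm_eq_abs,
        abs_of_nonneg (by positivity)]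
    have hα : ‖α + n‖ ≤ (‖α‖ + 1) * (n + 1) := by
      refine (norm_add_le _ _).trans ?_
      rw [Complex.norm_natCast]
      nlinarith [norm_nonneg α, mul_nonneg (norm_nonneg α) n.cast_nonneg (α := ℝ)]
    rw [norm_mul, norm_mul, norm_mul, hn, hcn] at h
    have hlow : ((n : ℝ) + 1) / 2 ≤ c + n := by
      have : (0 : ℝ) ≤ n := n.cast_nonneg
      linarith
    set x := ‖kummerCoeff α c (n + 1)‖
    have hx : ((n : ℝ) + 1) / 2 * ((n + 1) * x)
        ≤ (‖α‖ + 1) * (n + 1) * ((2 * (‖α‖ + 1)) ^ n / (Nat.factorial n : ℝ)) := by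
      calc _ ≤ (c + n) * ((n + 1) * x) := by gcongr
        _ = _ := h
        _ ≤ _ := by gcongr
    have hp : (0 : ℝ) < ((n : ℝ) + 1) / 2 * (n + 1) := by positivity
    refine le_of_mul_le_mul_left ?_ hp
    rw [mul_assoc]
    refine hx.trans_eq ?_
    have := Nat.factorial_ne_zero n
    rw [Nat.factorial_succ]
    push_cast
    field_simp
    ring

/-- Kummer's function `₁F₁(α; c; t)`, for real `c ≥ 1/2`, is twice differentiable and solves
Kummer's equation `t F″ + (c - t) F′ - α F = 0`. -/
theorem exists_kummer_derivs (α : ℂ) {c : ℝ} (hc : 1 / 2 ≤ c) :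
    ∃ F' F'' : ℂ → ℂ,
      (∀ t, HasDerivAt (fun t => ∑' n, kummerCoeff α c n * t ^ n) (F' t) t) ∧
      (∀ t, HasDerivAt F' (F'' t) t) ∧
      ∀ t, t * F'' t + (c - t) * F' t - α * ∑' n, kummerCoeff α c n * t ^ n = 0 := by
  have hb := kummerCoeff_isExpType α hc
  refine ⟨_, _, hb.hasDerivAt, hb.derivCoeff.hasDerivAt, fun t => ?_⟩
  have hne : ∀ n : ℕ, (c : ℂ) + n ≠ 0 := fun n => by
    have : c + (n : ℝ) ≠ 0 := by positivity
    exact_mod_cast this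
  have h := ((hb.derivCoeff.hasSum_mul_derivCoeff t).add
    (((hb.derivCoeff.summable t).hasSum.mul_left (c : ℂ)).sub (hb.hasSum_mul_derivCoeff t))).sub
    ((hb.summable t).hasSum.mul_left α)
  have h0 := h.unique (hasSum_zero.congr_fun fun n => by
    simp only [derivCoeff]
    linear_combination t ^ n * kummerCoeff_succ α hne n)
  linear_combination h0

theorem tsum_mul_zero_pow (b : ℕ → ℂ) : ∑' n, b n * (0 : ℂ) ^ n = b 0 := by
  rw [tsum_eq_single 0 fun n hn => by simp [hn]]
  simp

theorem hasDerivAt_exp_neg_sq_div_four (z : ℂ) :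
    HasDerivAt (fun z : ℂ => Complex.exp (-z ^ 2 / 4))
      (-z / 2 * Complex.exp (-z ^ 2 / 4)) z := by
  refine (((hasDerivAt_pow 2 z).neg.div_const 4).cexp).congr_deriv ?_
  simp
  ring

theorem hasDerivAt_comp_sq_div_two {F : ℂ → ℂ} {z F' : ℂ} (hF : HasDerivAt F F' (z ^ 2 / 2)) :
    HasDerivAt (fun z : ℂ => F (z ^ 2 / 2)) (z * F') z := by
  refine (hF.comp z ((hasDerivAt_pow 2 z).div_const 2)).congr_deriv ?_
  simp
  ring

theorem exists_weberM1_deriv (a : ℂ) : ∃ D : ℂ → ℂ,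
    (∀ z, HasDerivAt (weberM1 a) (D z) z) ∧
    (∀ z, HasDerivAt D ((z ^ 2 / 4 - a) * weberM1 a z) z) ∧ weberM1 a 0 = 1 := by
  obtain ⟨F', F'', h1, h2, h3⟩ := exists_kummer_derivs (1 / 4 - a / 2) (le_refl (1 / 2 : ℝ))
  push_cast at h1 h3
  set F : ℂ → ℂ := fun t => ∑' n, kummerCoeff (1 / 4 - a / 2) (1 / 2) n * t ^ n with hF
  have hM : weberM1 a = fun z => Complex.exp (-z ^ 2 / 4) * F (z ^ 2 / 2) := rfl
  have hM0 : weberM1 a 0 = 1 := by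
    simp [hM, hF, tsum_mul_zero_pow, kummerCoeff, cAscFact]
  refine ⟨fun z => Complex.exp (-z ^ 2 / 4) *
    (z * F' (z ^ 2 / 2) - z / 2 * F (z ^ 2 / 2)), fun z => ?_, fun z => ?_, hM0⟩
  · rw [hM]
    refine ((hasDerivAt_exp_neg_sq_div_four z).mul
      (hasDerivAt_comp_sq_div_two (h1 _))).congr_deriv ?_
    ring
  · refine ((hasDerivAt_exp_neg_sq_div_four z).mul
      (((hasDerivAt_id z).mul (hasDerivAt_comp_sq_div_two (h2 _))).sub
        (((hasDerivAt_id z).div_const 2).mul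
          (hasDerivAt_comp_sq_div_two (h1 _))))).congr_deriv ?_
    simp only [hM, id, Pi.mul_apply, Pi.sub_apply]
    linear_combination 2 * Complex.exp (-z ^ 2 / 4) * h3 (z ^ 2 / 2)

theorem exists_weberM2_deriv (a : ℂ) : ∃ D : ℂ → ℂ,
    (∀ z, HasDerivAt (weberM2 a) (D z) z) ∧
    (∀ z, HasDerivAt D ((z ^ 2 / 4 - a) * weberM2 a z) z) ∧ weberM2 a 0 = 0 ∧ D 0 = 1 := by
  obtain ⟨F', F'', h1, h2, h3⟩ :=
    exists_kummer_derivs (3 / 4 - a / 2) (by norm_num : (1 / 2 : ℝ) ≤ 3 / 2)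
  push_cast at h1 h3
  set F : ℂ → ℂ := fun t => ∑' n, kummerCoeff (3 / 4 - a / 2) (3 / 2) n * t ^ n with hF
  have hM : weberM2 a = fun z => z * Complex.exp (-z ^ 2 / 4) * F (z ^ 2 / 2) := rfl
  refine ⟨fun z => Complex.exp (-z ^ 2 / 4) * (F (z ^ 2 / 2) +
    z ^ 2 * (F' (z ^ 2 / 2) - F (z ^ 2 / 2) / 2)), fun z => ?_, fun z => ?_, by simp [hM], ?_⟩
  · rw [hM]
    refine (((hasDerivAt_id z).mul (hasDerivAt_exp_neg_sq_div_four z)).mul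
      (hasDerivAt_comp_sq_div_two (h1 _))).congr_deriv ?_
    simp only [id, Pi.mul_apply]
    ring
  · have hF1 := hasDerivAt_comp_sq_div_two (h1 (z ^ 2 / 2))
    have hF2 := hasDerivAt_comp_sq_div_two (h2 (z ^ 2 / 2))
    refine ((hasDerivAt_exp_neg_sq_div_four z).mul
      (hF1.add ((hasDerivAt_pow 2 z).mul (hF2.sub (hF1.div_const 2))))).congr_deriv ?_
    simp only [hM, Pi.mul_apply, Pi.sub_apply, Pi.add_apply]
    push_cast
    linear_combination 2 * z * Complex.exp (-z ^ 2 / 4) * h3 (z ^ 2 / 2)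
  · simp [hF, tsum_mul_zero_pow, kummerCoeff, cAscFact]

theorem wronskian_const {q M N D E : ℂ → ℂ} (hM : ∀ z, HasDerivAt M (D z) z)
    (hD : ∀ z, HasDerivAt D (q z * M z) z) (hN : ∀ z, HasDerivAt N (E z) z)
    (hE : ∀ z, HasDerivAt E (q z * N z) z) (z w : ℂ) :
    M z * E z - D z * N z = M w * E w - D w * N w := by
  have h : ∀ z, HasDerivAt (fun z => M z * E z - D z * N z) 0 z := fun z => by
    refine (((hM z).mul (hE z)).sub ((hD z).mul (hN z))).congr_deriv ?_
    ring
  exact is_const_of_deriv_eq_zero (fun z => (h z).differentiableAt) (fun z => (h z).deriv) z w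

theorem integrableOn_Iic_of_continuous {f : ℝ → ℂ} (hf : Continuous f)
    (h0 : IntegrableOn f (Iic 0)) (s : ℝ) : IntegrableOn f (Iic s) := by
  refine (h0.union (hf.integrableOn_Icc (a := 0) (b := s))).mono_set fun x hx => ?_
  rcases le_total x 0 with h | h
  · exact Or.inl h
  · exact Or.inr ⟨h, hx⟩

theorem hasDerivAt_integral_Iic {f : ℝ → ℂ} (hf : Continuous f)
    (h0 : IntegrableOn f (Iic 0)) (s : ℝ) :
    HasDerivAt (fun s => ∫ w in Iic s, f w) (f s) s := by
  have heq : (fun s => ∫ w in Iic s, f w) =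
      fun s => (∫ w in Iic (0 : ℝ), f w) + ∫ w in (0 : ℝ)..s, f w := by
    funext s
    rw [← intervalIntegral.integral_Iic_sub_Iic h0 (integrableOn_Iic_of_continuous hf h0 s)]
    ring
  rw [heq]
  exact (hf.integral_hasStrictDerivAt 0 s).hasDerivAt.const_add _

/-- For continuous `g` with `w ↦ g(w/√2) M₁(w;a)` and `w ↦ g(w/√2) M₂(w;a)`
integrable on `(−∞, 0]`, the variation-of-parameters function `M_p` is twice differentiable
on `ℝ` and solves the non-homogeneous Weber equation `M_p″(s) − (s²/4 − a) M_p(s) = g(s/√2)`. -/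
theorem weberParticular_solves_nonhomogeneous (a : ℂ) (g : ℝ → ℂ) (hg : Continuous g)
    (h1 : IntegrableOn (fun w : ℝ => g (w / Real.sqrt 2) * weberM1 a w) (Iic 0))
    (h2 : IntegrableOn (fun w : ℝ => g (w / Real.sqrt 2) * weberM2 a w) (Iic 0)) :
    (∀ s : ℝ, DifferentiableAt ℝ (weberParticular a g) s) ∧
    (∀ s : ℝ, DifferentiableAt ℝ (deriv (weberParticular a g)) s) ∧
    ∀ s : ℝ, deriv (deriv (weberParticular a g)) s
        - ((s : ℂ) ^ 2 / 4 - a) * weberParticular a g s = g (s / Real.sqrt 2) := by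
  obtain ⟨D, hM, hD, hM0⟩ := exists_weberM1_deriv a
  obtain ⟨E, hN, hE, hN0, hE0⟩ := exists_weberM2_deriv a
  have hW (z : ℂ) : weberM1 a z * E z - D z * weberM2 a z = 1 := by
    rw [wronskian_const hM hD hN hE z 0, hM0, hN0, hE0]
    ring
  have hgc : Continuous fun w : ℝ => g (w / Real.sqrt 2) := by fun_prop
  have hMc : Continuous (weberM1 a) :=
    continuous_iff_continuousAt.2 fun z => (hM z).continuousAt
  have hNc : Continuous (weberM2 a) :=
    continuous_iff_continuousAt.2 fun z => (hN z).continuousAt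
  have hf1 : Continuous fun w : ℝ => g (w / Real.sqrt 2) * weberM1 a w :=
    hgc.mul (hMc.comp Complex.continuous_ofReal)
  have hf2 : Continuous fun w : ℝ => g (w / Real.sqrt 2) * weberM2 a w :=
    hgc.mul (hNc.comp Complex.continuous_ofReal)
  have hI (s : ℝ) := hasDerivAt_integral_Iic hf1 h1 s
  have hJ (s : ℝ) := hasDerivAt_integral_Iic hf2 h2 s
  set I : ℝ → ℂ := fun s => ∫ w in Iic s, g (w / Real.sqrt 2) * weberM1 a w with hIdef
  set J : ℝ → ℂ := fun s => ∫ w in Iic s, g (w / Real.sqrt 2) * weberM2 a w with hJdef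
  have hP : weberParticular a g = fun s : ℝ => I s * weberM2 a s - J s * weberM1 a s := by
    funext s
    simp only [hIdef, hJdef, weberParticular]
    rw [← integral_mul_const, ← integral_mul_const, ← integral_sub
      ((integrableOn_Iic_of_continuous hf1 h1 s).mul_const _)
      ((integrableOn_Iic_of_continuous hf2 h2 s).mul_const _)]
    congr 1
    funext w
    ring
  have hP1 (s : ℝ) : HasDerivAt (weberParticular a g) (I s * E s - J s * D s) s := by
    rw [hP]
    refine (((hI s).mul (hN s).comp_ofReal).sub
      ((hJ s).mul (hM s).comp_ofReal)).congr_deriv ?_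
    ring
  have hP2 (s : ℝ) : HasDerivAt (deriv (weberParticular a g))
      (((s : ℂ) ^ 2 / 4 - a) * weberParticular a g s + g (s / Real.sqrt 2)) s := by
    rw [funext fun s => (hP1 s).deriv]
    refine (((hI s).mul (hE s).comp_ofReal).sub
      ((hJ s).mul (hD s).comp_ofReal)).congr_deriv ?_
    rw [hP]
    linear_combination g (s / Real.sqrt 2) * hW s
  refine ⟨fun s => (hP1 s).differentiableAt, fun s => (hP2 s).differentiableAt, fun s => ?_⟩
  rw [(hP2 s).deriv]
  ring
end
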